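/- Let p be a prime number. A morphism φ: S → R of commutative F_p-algebras is p-power surjective if and only if the induced map S[x] → R[x] between polynomial rings in one variable is power surjective. -/

import Mathlib

universe u

/-- A map of rings (or monoids) is power surjective if every element of the target has
a positive power in the image. -/
def PowerSurjective {R S : Type u} [Monoid R] [Monoid S] (f : R → S) : Prop :=
  ∀ s : S, ∃ n : ℕ, 0 < n ∧ s ^ n ∈ Set.range f

/-- For a prime `p`, a map of rings is `p`-power surjective if every element of the
target has a `pⁿ`-th power in the image. -/
def PPowerSurjective (p : ℕ) {R S : Type u} [Monoid R] [Monoid S] (f : R → S) : Prop :=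
  ∀ s : S, ∃ n : ℕ, s ^ p ^ n ∈ Set.range f

/-- `p`-power surjectivity passes to polynomial rings in characteristic `p`. -/
theorem PPowerSurjective.polynomial_map {p : ℕ} [Fact p.Prime] {S R : Type u}
    [CommRing S] [CommRing R] [CharP R p] {φ : S →+* R} (h : PPowerSurjective p φ) :
    PPowerSurjective p (Polynomial.mapRingHom φ) := by
  intro f
  induction f using Polynomial.induction_on' with
  | add f g hf hg =>
    obtain ⟨a, F, hF⟩ := hf
    obtain ⟨b, G, hG⟩ := hg
    refine ⟨a + b, F ^ p ^ b + G ^ p ^ a, ?_⟩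
    rw [map_add, map_pow, map_pow, hF, hG, add_pow_char_pow, ← pow_mul, ← pow_mul, ← pow_add,
      ← pow_add, add_comm b a]
  | monomial k r =>
    obtain ⟨n, s, hs⟩ := h r
    exact ⟨n, Polynomial.monomial (k * p ^ n) s, by
      rw [Polynomial.coe_mapRingHom, Polynomial.map_monomial, hs, Polynomial.monomial_pow]⟩

/-- In characteristic `p`, the coefficient of `X ^ p ^ k` in `(1 + r X) ^ (p ^ k * m)` is
`m * r ^ p ^ k`. -/
theorem coeff_one_add_C_mul_X_pow_char_pow_mul {p : ℕ} [Fact p.Prime] {R : Type u}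
    [CommRing R] [CharP R p] (r : R) (k m : ℕ) :
    ((1 + Polynomial.C r * Polynomial.X) ^ (p ^ k * m)).coeff (p ^ k) = m * r ^ p ^ k := by
  have hpk : 0 < p ^ k := pow_pos (Fact.out : p.Prime).pos k
  have hexpand : (1 + Polynomial.C r * Polynomial.X) ^ (p ^ k * m) =
      Polynomial.expand R (p ^ k) ((1 + Polynomial.C (r ^ p ^ k) * Polynomial.X) ^ m) := by
    simp [pow_mul, add_pow_char_pow, mul_pow]
  have hcoeff := Polynomial.coeff_expand_mul hpk
    ((1 + Polynomial.C (r ^ p ^ k) * Polynomial.X) ^ m) 1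
  rw [one_mul] at hcoeff
  rw [hexpand, hcoeff]
  have hderiv := Polynomial.coeff_derivative
    ((1 + Polynomial.C (r ^ p ^ k) * Polynomial.X) ^ m) 0
  rw [Polynomial.derivative_pow, Polynomial.coeff_zero_eq_eval_zero] at hderiv
  simpa using hderiv.symm

/-! ## STATEMENT 4:
Let `p` be a prime number.  A morphism `φ : S → R` of commutative `𝔽_p`-algebras
(i.e. commutative rings of characteristic `p`) is `p`-power surjective if and only if the
induced map `S[x] → R[x]` between polynomial rings in one variable is power surjective. -/
theorem pPowerSurjective_iff_powerSurjective_polynomial_map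
    (p : ℕ) (hp : p.Prime) (S R : Type u) [CommRing S] [CommRing R]
    [CharP S p] [CharP R p] (φ : S →+* R) :
    PPowerSurjective p ⇑φ ↔ PowerSurjective ⇑(Polynomial.mapRingHom φ) := by
  have : Fact p.Prime := ⟨hp⟩
  refine ⟨fun h f => ?_, fun h r => ?_⟩
  · obtain ⟨n, hn⟩ := h.polynomial_map f
    exact ⟨p ^ n, pow_pos hp.pos n, hn⟩
  · obtain ⟨n, hn, F, hF⟩ := h (1 + Polynomial.C r * Polynomial.X)
    obtain ⟨k, m, hpm, rfl⟩ := Nat.exists_eq_pow_mul_and_not_dvd hn.ne' p hp.ne_one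
    have hunit : IsUnit (m : R) := (CharP.isUnit_natCast_iff hp).2 hpm
    have hunit_source : IsUnit (m : S) := (CharP.isUnit_natCast_iff hp).2 hpm
    obtain ⟨u, hu⟩ := hunit_source.exists_right_inv
    have hcoeff : φ (F.coeff (p ^ k)) = m * r ^ p ^ k := by
      rw [← coeff_one_add_C_mul_X_pow_char_pow_mul, ← hF, Polynomial.coe_mapRingHom,
        Polynomial.coeff_map]
    refine ⟨k, u * F.coeff (p ^ k), hunit.mul_left_cancel ?_⟩
    rw [← hcoeff, ← map_natCast φ m, ← map_mul, ← mul_assoc, hu, one_mul]
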